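/- Let C be a decomposition finite category, B_ℚ the free ℚ-vector space on its morphisms with the deconcatenation coproduct Δ, and N the ℚ-span of all differences f − g with f ∼ g. Define the ℚ-linear map ε̄ : B_ℚ → ℚ on a morphism f : X → Y by ε̄(f) = 1 / (|Iso(X)| · |Aut(X)|) if f is an isomorphism and ε̄(f) = 0 otherwise, where |Aut(X)| is the (finite) number of automorphisms of X and |Iso(X)| is the (finite) number of objects isomorphic to X. Then ε̄ vanishes on N, and ε̄ is a counit modulo N: for every morphism f, (ε̄ ⊗ id)(Δ(f)) − f ∈ N and (id ⊗ ε̄)(Δ(f)) − f ∈ N. Hence ε̄ induces a counit for the induced coproduct on B_ℚ/N. -/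

import Mathlib

open CategoryTheory
open scoped TensorProduct

universe v u

variable (C : Type u) [Category.{v} C]

/-- The type of all morphisms of `C`. -/
def Mor := Σ (X : C) (Y : C), X ⟶ Y

/-- The type of factorizations `φ = φ₀ ∘ φ₁` of a morphism. -/
def Factorizations {X Y : C} (φ : X ⟶ Y) : Type max u v :=
  {p : Σ Z : C, (X ⟶ Z) × (Z ⟶ Y) // p.2.1 ≫ p.2.2 = φ}

/-- A category is decomposition finite if every morphism has only finitely many
factorizations. -/
def DecompositionFinite : Prop :=
  ∀ (X Y : C) (φ : X ⟶ Y), Finite (Factorizations C φ)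

/-- The free `ℚ`-vector space on the set of morphisms of `C`. -/
abbrev MorModQ := Mor C →₀ ℚ

/-- The basis element corresponding to a morphism. -/
noncomputable def morGen {X Y : C} (φ : X ⟶ Y) : MorModQ C :=
  Finsupp.single ⟨X, Y, φ⟩ 1

/-- The deconcatenation coproduct: `Δ(φ) = Σ_{φ = φ₀ ∘ φ₁} φ₀ ⊗ φ₁`. -/
noncomputable def coprod : MorModQ C →ₗ[ℚ] MorModQ C ⊗[ℚ] MorModQ C :=
  Finsupp.lift (MorModQ C ⊗[ℚ] MorModQ C) ℚ (Mor C) fun m =>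
    ∑ᶠ p : Factorizations C m.2.2,
      morGen C p.1.2.2 ⊗ₜ[ℚ] morGen C p.1.2.1

/-- Morphisms `f : X ⟶ Y` and `g : X' ⟶ Y'` are equivalent if there are isomorphisms
`σ : X ≅ X'` and `σ' : Y ≅ Y'` with `g ∘ σ = σ' ∘ f`. -/
def MorEquiv {X Y X' Y' : C} (f : X ⟶ Y) (g : X' ⟶ Y') : Prop :=
  ∃ (σ : X ≅ X') (σ' : Y ≅ Y'), σ.hom ≫ g = f ≫ σ'.hom

/-- The `ℚ`-span of the differences `f − g` for equivalent morphisms `f ∼ g`. -/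
noncomputable def equivDiffs : Submodule ℚ (MorModQ C) :=
  Submodule.span ℚ
    {x : MorModQ C | ∃ (X Y X' Y' : C) (f : X ⟶ Y) (g : X' ⟶ Y'),
      MorEquiv C f g ∧ x = morGen C f - morGen C g}

/-- The normalized counit `ε̄`, sending an isomorphism `f : X ⟶ Y` to
`1 / (|Iso(X)| ⬝ |Aut(X)|)` and every non-isomorphism to `0`. -/
noncomputable def counitBar : MorModQ C →ₗ[ℚ] ℚ :=
  Finsupp.lift ℚ ℚ (Mor C) fun m =>
    letI := Classical.propDecidable (IsIso m.2.2)
    if IsIso m.2.2 then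
      1 / ((Nat.card {Y : C // Nonempty (m.1 ≅ Y)} : ℚ) * (Nat.card (m.1 ≅ m.1) : ℚ))
    else 0

noncomputable def isoCount (X : C) : ℕ := Nat.card (Σ Z : C, (X ≅ Z))

noncomputable def isoSigmaEquiv (X : C) :
    (Σ Z : C, (X ≅ Z)) ≃ {Y : C // Nonempty (X ≅ Y)} × (X ≅ X) where
  toFun p := (⟨p.1, ⟨p.2⟩⟩, p.2 ≪≫ (Classical.choice (⟨p.2⟩ : Nonempty (X ≅ p.1))).symm)
  invFun q := ⟨q.1.1, q.2 ≪≫ Classical.choice q.1.2⟩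
  left_inv p := by
    rcases p with ⟨Z, e⟩
    simp
  right_inv q := by
    rcases q with ⟨⟨Z, e⟩, a⟩
    simp

theorem isoCount_eq (X : C) :
    isoCount C X = Nat.card {Y : C // Nonempty (X ≅ Y)} * Nat.card (X ≅ X) := by
  rw [isoCount, Nat.card_congr (isoSigmaEquiv C X), Nat.card_prod]

theorem isoCount_congr {X X' : C} (e : X ≅ X') : isoCount C X = isoCount C X' := by
  refine Nat.card_congr (Equiv.sigmaCongrRight fun Z => ?_)
  exact ⟨fun a => e.symm ≪≫ a, fun a => e ≪≫ a, fun a => by simp, fun a => by simp⟩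

theorem lift_single_one {ι V : Type*} [AddCommGroup V] [Module ℚ V] (F : ι → V) (i : ι) :
    Finsupp.lift V ℚ ι F (Finsupp.single i 1) = F i := by
  simp

theorem counitBar_iso {X Y : C} (f : X ⟶ Y) (hf : IsIso f) :
    counitBar C (morGen C f) = 1 / (isoCount C X : ℚ) := by
  rw [isoCount_eq, Nat.cast_mul]
  exact (lift_single_one (ι := Mor C) _ ⟨X, Y, f⟩).trans (if_pos hf)

theorem counitBar_not_iso {X Y : C} (f : X ⟶ Y) (hf : ¬ IsIso f) :
    counitBar C (morGen C f) = 0 := by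
  exact (lift_single_one (ι := Mor C) _ ⟨X, Y, f⟩).trans (if_neg hf)

theorem mk_eq_of_equiv {X Y X' Y' : C} (f : X ⟶ Y) (g : X' ⟶ Y') (h : MorEquiv C f g) :
    (equivDiffs C).mkQ (morGen C f) = (equivDiffs C).mkQ (morGen C g) := by
  rw [← sub_eq_zero, ← map_sub, Submodule.mkQ_apply, Submodule.Quotient.mk_eq_zero]
  exact Submodule.subset_span ⟨X, Y, X', Y', f, g, h, rfl⟩

theorem counitBar_equiv {X Y X' Y' : C} (f : X ⟶ Y) (g : X' ⟶ Y') (h : MorEquiv C f g) :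
    counitBar C (morGen C f) = counitBar C (morGen C g) := by
  obtain ⟨σ, σ', e⟩ := h
  by_cases hf : IsIso f
  · have hg : IsIso g := by
      have : g = σ.inv ≫ f ≫ σ'.hom := by rw [← e]; simp
      rw [this]; infer_instance
    rw [counitBar_iso C f hf, counitBar_iso C g hg, isoCount_congr C σ]
  · have hg : ¬ IsIso g := by
      intro hg
      have : f = σ.hom ≫ g ≫ σ'.inv := by rw [← Category.assoc, e]; simp
      exact hf (by rw [this]; infer_instance)
    rw [counitBar_not_iso C f hf, counitBar_not_iso C g hg]

theorem counitBar_vanish : ∀ x ∈ equivDiffs C, counitBar C x = 0 := by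
  intro x hx
  have : equivDiffs C ≤ LinearMap.ker (counitBar C) := by
    refine Submodule.span_le.2 ?_
    rintro _ ⟨X, Y, X', Y', f, g, h, rfl⟩
    simp [counitBar_equiv C f g h]
  exact this hx

noncomputable def leftEquiv {X Y : C} (f : X ⟶ Y) :
    {p : Factorizations C f // IsIso p.1.2.2} ≃ (Σ Z : C, (Y ≅ Z)) where
  toFun p := ⟨p.1.1.1, (@asIso _ _ _ _ p.1.1.2.2 p.2).symm⟩
  invFun q := ⟨⟨⟨q.1, (f ≫ q.2.hom, q.2.inv)⟩, by simp⟩, by dsimp; infer_instance⟩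
  left_inv p := by
    rcases p with ⟨⟨⟨Z, a, b⟩, rfl⟩, hb⟩
    dsimp only at hb
    simp
  right_inv q := by
    rcases q with ⟨Z, e⟩
    simp only [Sigma.mk.injEq, heq_eq_eq, true_and]
    ext
    simp

noncomputable def rightEquiv {X Y : C} (f : X ⟶ Y) :
    {p : Factorizations C f // IsIso p.1.2.1} ≃ (Σ Z : C, (X ≅ Z)) where
  toFun p := ⟨p.1.1.1, @asIso _ _ _ _ p.1.1.2.1 p.2⟩
  invFun q := ⟨⟨⟨q.1, (q.2.hom, q.2.inv ≫ f)⟩, by simp⟩, by dsimp; infer_instance⟩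
  left_inv p := by
    rcases p with ⟨⟨⟨Z, a, b⟩, rfl⟩, hb⟩
    dsimp only at hb
    simp
  right_inv q := by
    rcases q with ⟨Z, e⟩
    simp only [Sigma.mk.injEq, heq_eq_eq, true_and]
    ext
    simp

theorem finite_sigma (h : DecompositionFinite C) (X : C) : Finite (Σ Z : C, (X ≅ Z)) := by
  have := h X X (𝟙 X)
  exact Finite.of_equiv _ (rightEquiv C (𝟙 X))

theorem isoCount_ne_zero (h : DecompositionFinite C) (X : C) : (isoCount C X : ℚ) ≠ 0 := by
  have := finite_sigma C h X
  have : Nonempty (Σ Z : C, (X ≅ Z)) := ⟨⟨X, Iso.refl X⟩⟩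
  exact_mod_cast (Nat.card_pos (α := Σ Z : C, (X ≅ Z))).ne'

theorem sum_aux {ι V : Type*} [Fintype ι] [AddCommGroup V] [Module ℚ V] (P : ι → Prop)
    (c : ι → ℚ) (w : ι → V) (v : V) (k : ℕ) (hk : (k : ℚ) ≠ 0) (hcard : Nat.card {i // P i} = k)
    (h1 : ∀ i, P i → c i = 1 / (k : ℚ)) (h0 : ∀ i, ¬ P i → c i = 0) (hw : ∀ i, P i → w i = v) :
    ∑ i, c i • w i = v := by
  classical
  have : ∀ i, c i • w i = if P i then (1 / (k : ℚ)) • v else 0 := by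
    intro i
    split_ifs with hp
    · rw [h1 i hp, hw i hp]
    · rw [h0 i hp, zero_smul]
  rw [Finset.sum_congr rfl fun i _ => this i, ← Finset.sum_filter, Finset.sum_const]
  rw [← Fintype.card_subtype, ← Nat.card_eq_fintype_card, hcard, ← Nat.cast_smul_eq_nsmul ℚ,
    smul_smul, mul_one_div_cancel hk, one_smul]

theorem left_counit (h : DecompositionFinite C) (m : Mor C) :
    (TensorProduct.lid ℚ (MorModQ C))
        ((TensorProduct.map (counitBar C) LinearMap.id) (coprod C (Finsupp.single m 1)))
      - Finsupp.single m 1 ∈ equivDiffs C := by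
  obtain ⟨X, Y, f⟩ := m
  have := h X Y f
  let _ := Fintype.ofFinite (Factorizations C f)
  rw [← Submodule.Quotient.mk_eq_zero, ← Submodule.mkQ_apply, map_sub, sub_eq_zero]
  have e : coprod C (Finsupp.single (⟨X, Y, f⟩ : Mor C) 1) =
      ∑ p : Factorizations C f, morGen C p.1.2.2 ⊗ₜ[ℚ] morGen C p.1.2.1 := by
    exact (lift_single_one (ι := Mor C) _ ⟨X, Y, f⟩).trans (finsum_eq_sum_of_fintype _)
  rw [e]
  simp only [map_sum, TensorProduct.map_tmul, TensorProduct.lid_tmul, map_smul, LinearMap.id_apply]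
  refine sum_aux (fun p : Factorizations C f => IsIso p.1.2.2) _ _ _ (isoCount C Y)
    (isoCount_ne_zero C h Y) (Nat.card_congr (leftEquiv C f)) ?_ ?_ ?_
  · intro p hp
    rw [counitBar_iso C _ hp, isoCount_congr C (@asIso _ _ _ _ p.1.2.2 hp)]
  · intro p hp
    exact counitBar_not_iso C _ hp
  · intro p hp
    exact mk_eq_of_equiv C _ f ⟨Iso.refl X, @asIso _ _ _ _ p.1.2.2 hp, by simp [p.2]⟩

theorem right_counit (h : DecompositionFinite C) (m : Mor C) :
    (TensorProduct.rid ℚ (MorModQ C))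
        ((TensorProduct.map LinearMap.id (counitBar C)) (coprod C (Finsupp.single m 1)))
      - Finsupp.single m 1 ∈ equivDiffs C := by
  obtain ⟨X, Y, f⟩ := m
  have := h X Y f
  let _ := Fintype.ofFinite (Factorizations C f)
  rw [← Submodule.Quotient.mk_eq_zero, ← Submodule.mkQ_apply, map_sub, sub_eq_zero]
  have e : coprod C (Finsupp.single (⟨X, Y, f⟩ : Mor C) 1) =
      ∑ p : Factorizations C f, morGen C p.1.2.2 ⊗ₜ[ℚ] morGen C p.1.2.1 := by
    exact (lift_single_one (ι := Mor C) _ ⟨X, Y, f⟩).trans (finsum_eq_sum_of_fintype _)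
  rw [e]
  simp only [map_sum, TensorProduct.map_tmul, TensorProduct.rid_tmul, map_smul, LinearMap.id_apply]
  refine sum_aux (fun p : Factorizations C f => IsIso p.1.2.1) _ _ _ (isoCount C X)
    (isoCount_ne_zero C h X) (Nat.card_congr (rightEquiv C f)) ?_ ?_ ?_
  · intro p hp
    rw [counitBar_iso C _ hp]
  · intro p hp
    exact counitBar_not_iso C _ hp
  · intro p hp
    exact mk_eq_of_equiv C _ f ⟨(@asIso _ _ _ _ p.1.2.1 hp).symm, Iso.refl Y, by
      have e2 := p.2
      have e3 : f = p.1.2.1 ≫ p.1.2.2 := e2.symm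
      refine (congrArg (fun t => (@asIso _ _ _ _ p.1.2.1 hp).symm.hom ≫ t) e3).trans ?_
      simp⟩

theorem counitBar_descends (h : DecompositionFinite C) :
    (∀ x ∈ equivDiffs C, counitBar C x = 0)
    ∧ (∀ m : Mor C,
        (TensorProduct.lid ℚ (MorModQ C))
            ((TensorProduct.map (counitBar C) LinearMap.id) (coprod C (Finsupp.single m 1)))
          - Finsupp.single m 1 ∈ equivDiffs C)
    ∧ (∀ m : Mor C,
        (TensorProduct.rid ℚ (MorModQ C))
            ((TensorProduct.map LinearMap.id (counitBar C)) (coprod C (Finsupp.single m 1)))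
          - Finsupp.single m 1 ∈ equivDiffs C)
    ∧ ∃ εq : (MorModQ C ⧸ equivDiffs C) →ₗ[ℚ] ℚ,
        (∀ b : MorModQ C, εq (Submodule.Quotient.mk b) = counitBar C b)
        ∧ ∀ Δbar : (MorModQ C ⧸ equivDiffs C) →ₗ[ℚ]
              (MorModQ C ⧸ equivDiffs C) ⊗[ℚ] (MorModQ C ⧸ equivDiffs C),
            (∀ b : MorModQ C,
              Δbar (Submodule.Quotient.mk b)
                = (TensorProduct.map (equivDiffs C).mkQ (equivDiffs C).mkQ) (coprod C b)) →
            ((TensorProduct.lid ℚ _).toLinearMap.comp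
                ((TensorProduct.map εq LinearMap.id).comp Δbar) = LinearMap.id
            ∧ (TensorProduct.rid ℚ _).toLinearMap.comp
                ((TensorProduct.map LinearMap.id εq).comp Δbar) = LinearMap.id) := by
  refine ⟨counitBar_vanish C, left_counit C h, right_counit C h,
    (equivDiffs C).liftQ (counitBar C) (counitBar_vanish C), fun b => rfl, ?_⟩
  intro Δbar hΔ
  have hε : ((equivDiffs C).liftQ (counitBar C) (counitBar_vanish C)) ∘ₗ (equivDiffs C).mkQ
      = counitBar C := Submodule.liftQ_mkQ _ _ _
  constructor
  · apply Submodule.linearMap_qext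
    apply Finsupp.lhom_ext'
    intro m
    apply LinearMap.ext_ring
    have key := left_counit C h m
    rw [← Submodule.Quotient.mk_eq_zero, ← Submodule.mkQ_apply, map_sub, sub_eq_zero] at key
    simp only [LinearMap.comp_apply, Finsupp.lsingle_apply, Submodule.mkQ_apply, hΔ,
      LinearMap.id_apply, LinearEquiv.coe_coe] at key ⊢
    rw [← key, ← LinearMap.comp_apply, ← TensorProduct.map_comp, hε]
    generalize coprod C (Finsupp.single m 1) = t
    induction t with
    | zero => simp
    | tmul x y => simp
    | add x y hx hy => simp only [map_add, hx, hy, Submodule.Quotient.mk_add]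
  · apply Submodule.linearMap_qext
    apply Finsupp.lhom_ext'
    intro m
    apply LinearMap.ext_ring
    have key := right_counit C h m
    rw [← Submodule.Quotient.mk_eq_zero, ← Submodule.mkQ_apply, map_sub, sub_eq_zero] at key
    simp only [LinearMap.comp_apply, Finsupp.lsingle_apply, Submodule.mkQ_apply, hΔ,
      LinearMap.id_apply, LinearEquiv.coe_coe] at key ⊢
    rw [← key, ← LinearMap.comp_apply, ← TensorProduct.map_comp, hε]
    generalize coprod C (Finsupp.single m 1) = t
    induction t with
    | zero => simp
    | tmul x y => simp
    | add x y hx hy => simp only [map_add, hx, hy, Submodule.Quotient.mk_add]
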